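/- Let 0 < q < 1 and define P⁰(p,v,w) = (-q)^{p-w} J_{v-w}(q^{p-w}; q²) for p,v,w ∈ ℤ, where J is the ₁φ₁ q-Bessel function of integer order. Then (-q)^{-p} P⁰(p,v,w) is symmetric under all permutations of p, v, w, and P⁰(p,v,w) = P⁰(p-1, v-1, w-1). -/

import Mathlib

/-- The finite q-shifted factorial `(a;q)_k`. -/
noncomputable def qp (q a : ℝ) (k : ℕ) : ℝ := ∏ i ∈ Finset.range k, (1 - a * q ^ i)

/-- The infinite q-shifted factorial `(a;q)_∞`. -/
noncomputable def qpInf (q a : ℝ) : ℝ := ∏' i : ℕ, (1 - a * q ^ i)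

/-- The Wall polynomial `p_n(x;a;q) = ₂φ₁(q^{-n},0;aq;q,qx)` as a terminating sum. -/
noncomputable def wall (n : ℕ) (x a q : ℝ) : ℝ :=
  ∑ j ∈ Finset.range (n + 1), qp q (q ^ (-(n : ℤ))) j / (qp q (a * q) j * qp q q j) * (q * x) ^ j
/-- The `₁φ₁` q-Bessel function `J_n(x;q²)` of integer order `n`, in the combined form
`x^n (q²;q²)_∞⁻¹ Σ_k (-1)^k q^{k(k-1)} (q²x²)^k (q^{2n+2+2k};q²)_∞ / (q²;q²)_k`,
which encodes the standard convention for negative integer order. -/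
noncomputable def Jz (q : ℝ) (n : ℤ) (x : ℝ) : ℝ :=
  x ^ n * (∑' k : ℕ, (-1) ^ k * q ^ (k * (k - 1)) * (q ^ 2 * x ^ 2) ^ k *
      qpInf (q ^ 2) (q ^ (2 * n + 2 + 2 * (k : ℤ))) / qp (q ^ 2) (q ^ 2) k) /
    qpInf (q ^ 2) (q ^ 2)
/-- The kernel `P⁰(p,v,w) = (-q)^{p-w} J_{v-w}(q^{p-w};q²)`. -/
noncomputable def Pzero (q : ℝ) (p v w : ℤ) : ℝ :=
  (-q) ^ (p - w) * Jz q (v - w) (q ^ (p - w))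

open Filter Topology

/-- The `k`-th term of Euler's expansion of `(z;q²)_∞`. -/
noncomputable def eulerTerm (q z : ℝ) (k : ℕ) : ℝ :=
  (-1) ^ k * q ^ (k * (k - 1)) * z ^ k / qp (q ^ 2) (q ^ 2) k

theorem qp_succ (q a : ℝ) (k : ℕ) : qp q a (k + 1) = qp q a k * (1 - a * q ^ k) :=
  Finset.prod_range_succ _ _

theorem qp_add (q a : ℝ) (m n : ℕ) : qp q a (m + n) = qp q a m * qp q (a * q ^ m) n := by
  simp only [qp, Finset.prod_range_add]
  congr 1
  exact Finset.prod_congr rfl fun i _ => by ring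

theorem qp_self_pos {q : ℝ} (hq0 : 0 < q) (hq1 : q < 1) (k : ℕ) : 0 < qp q q k := by
  refine Finset.prod_pos fun i _ => ?_
  rw [← pow_succ']
  exact sub_pos.2 (pow_lt_one₀ hq0.le hq1 (Nat.succ_ne_zero i))

theorem tendsto_qp_qpInf {q : ℝ} (hq0 : 0 < q) (hq1 : q < 1) (a : ℝ) :
    Tendsto (qp q a) atTop (𝓝 (qpInf q a)) := by
  have h : Multipliable fun i : ℕ => 1 - a * q ^ i := by
    simpa [sub_eq_add_neg] using Real.multipliable_one_add_of_summable
      ((summable_geometric_of_lt_one hq0.le hq1).mul_left a).neg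
  exact h.hasProd.tendsto_prod_nat

theorem qpInf_eq_qp_mul {q : ℝ} (hq0 : 0 < q) (hq1 : q < 1) (a : ℝ) (n : ℕ) :
    qpInf q a = qp q a n * qpInf q (a * q ^ n) := by
  refine tendsto_nhds_unique
    ((tendsto_qp_qpInf hq0 hq1 a).comp (tendsto_add_atTop_nat n)) ?_
  refine ((tendsto_qp_qpInf hq0 hq1 (a * q ^ n)).const_mul (qp q a n)).congr fun m => ?_
  simp only [Function.comp, add_comm m n, qp_add]

theorem qpInf_eq_zero {q a : ℝ} (hq0 : 0 < q) (hq1 : q < 1) (i : ℕ) (h : a * q ^ i = 1) :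
    qpInf q a = 0 := by
  rw [qpInf_eq_qp_mul hq0 hq1 a (i + 1), qp_succ, h]
  ring

theorem eulerTerm_succ (q z : ℝ) (k : ℕ) : eulerTerm q z (k + 1) =
    -(z * (q ^ 2) ^ k / (1 - q ^ 2 * (q ^ 2) ^ k)) * eulerTerm q z k := by
  have h : (k + 1) * (k + 1 - 1) = k * (k - 1) + 2 * k := by
    cases k with
    | zero => rfl
    | succ k => simp only [Nat.add_sub_cancel]; ring
  simp only [eulerTerm, qp_succ, h, pow_add, pow_mul, pow_one, div_eq_mul_inv, mul_inv]
  ring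

theorem one_sub_sq_pow_pos {q : ℝ} (hq0 : 0 < q) (hq1 : q < 1) (k : ℕ) :
    0 < 1 - q ^ 2 * (q ^ 2) ^ k := by
  rw [← pow_succ', ← pow_mul]
  exact sub_pos.2 (pow_lt_one₀ hq0.le hq1 (by omega))

theorem summable_eulerTerm {q : ℝ} (hq0 : 0 < q) (hq1 : q < 1) (z : ℝ) :
    Summable (eulerTerm q z) := by
  rcases eq_or_ne z 0 with rfl | hz
  · refine summable_of_ne_finset_zero (s := {0}) fun k hk => ?_
    have : k ≠ 0 := by simpa using hk
    simp [eulerTerm, this]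
  have hQ : q ^ 2 < 1 := pow_lt_one₀ hq0.le hq1 two_ne_zero
  have hne (k : ℕ) : eulerTerm q z k ≠ 0 := by
    have := (qp_self_pos (pow_pos hq0 2) hQ k).ne'
    simp [eulerTerm, hz, hq0.ne', this]
  have hpow := tendsto_pow_atTop_nhds_zero_of_lt_one (sq_nonneg q) hQ
  have hlim : Tendsto (fun k : ℕ => ‖-(z * (q ^ 2) ^ k / (1 - q ^ 2 * (q ^ 2) ^ k))‖)
      atTop (𝓝 0) := by
    have := ((hpow.const_mul z).div ((hpow.const_mul (q ^ 2)).const_sub 1) (by simp)).neg.norm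
    simpa using this
  refine summable_of_ratio_test_tendsto_lt_one zero_lt_one (.of_forall hne) (hlim.congr fun k => ?_)
  rw [eulerTerm_succ, norm_mul, mul_div_cancel_right₀ _ (norm_ne_zero_iff.2 (hne k))]

theorem eulerTerm_mul (q z c : ℝ) (k : ℕ) : eulerTerm q (z * c) k = c ^ k * eulerTerm q z k := by
  simp only [eulerTerm, mul_pow]
  ring

theorem tsum_eulerTerm_eq_mul {q : ℝ} (hq0 : 0 < q) (hq1 : q < 1) (z : ℝ) :
    ∑' k, eulerTerm q z k = (1 - z) * ∑' k, eulerTerm q (z * q ^ 2) k := by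
  have hs := summable_eulerTerm hq0 hq1 z
  have hs' := summable_eulerTerm hq0 hq1 (z * q ^ 2)
  have hd : ∑' k, (eulerTerm q z k - eulerTerm q (z * q ^ 2) k)
      = ∑' k, -z * eulerTerm q (z * q ^ 2) k := by
    rw [(hs.sub hs').tsum_eq_zero_add]
    have h0 : eulerTerm q z 0 - eulerTerm q (z * q ^ 2) 0 = 0 := by simp [eulerTerm]
    rw [h0, zero_add]
    refine tsum_congr fun k => ?_
    have := (one_sub_sq_pow_pos hq0 hq1 k).ne'
    rw [eulerTerm_mul, eulerTerm_mul, eulerTerm_succ]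
    field_simp
    ring
  rw [hs.tsum_sub hs', tsum_mul_left] at hd
  linarith

/-- Euler's expansion of the infinite q-shifted factorial. -/
theorem tsum_eulerTerm {q : ℝ} (hq0 : 0 < q) (hq1 : q < 1) (z : ℝ) :
    ∑' k, eulerTerm q z k = qpInf (q ^ 2) z := by
  have hQ : q ^ 2 < 1 := pow_lt_one₀ hq0.le hq1 two_ne_zero
  have hiter (n : ℕ) : ∑' k, eulerTerm q z k
      = qp (q ^ 2) z n * ∑' k, eulerTerm q (z * (q ^ 2) ^ n) k := by
    induction n with
    | zero => simp [qp]
    | succ n ih =>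
      rw [ih, tsum_eulerTerm_eq_mul hq0 hq1, qp_succ, pow_succ]
      ring_nf
  have hlim : Tendsto (fun n : ℕ => ∑' k, eulerTerm q (z * (q ^ 2) ^ n) k) atTop
      (𝓝 (∑' k, eulerTerm q 0 k)) := by
    refine tendsto_tsum_of_dominated_convergence (summable_eulerTerm hq0 hq1 z).norm
      (fun k => ?_) (.of_forall fun n k => ?_)
    · have hc : Continuous fun y => eulerTerm q y k := by unfold eulerTerm; fun_prop
      refine (hc.tendsto 0).comp ?_
      simpa using (tendsto_pow_atTop_nhds_zero_of_lt_one (sq_nonneg q) hQ).const_mul z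
    · rw [eulerTerm_mul, norm_mul]
      refine mul_le_of_le_one_left (norm_nonneg _) ?_
      rw [Real.norm_of_nonneg (by positivity)]
      exact pow_le_one₀ (by positivity) (pow_le_one₀ (by positivity) hQ.le)
  have hzero : ∑' k, eulerTerm q 0 k = 1 := by
    rw [tsum_eq_single 0 fun k hk => by simp [eulerTerm, hk]]
    simp [eulerTerm, qp]
  rw [hzero] at hlim
  refine tendsto_nhds_unique (tendsto_const_nhds (f := atTop).congr hiter) ?_
  simpa using (tendsto_qp_qpInf (pow_pos hq0 2) hQ z).mul hlim

theorem tsum_eulerTerm_mul_qpInf_comm {q : ℝ} (hq0 : 0 < q) (hq1 : q < 1) (y z : ℝ) :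
    ∑' k, eulerTerm q y k * qpInf (q ^ 2) (z * (q ^ 2) ^ k)
      = ∑' k, eulerTerm q z k * qpInf (q ^ 2) (y * (q ^ 2) ^ k) := by
  have hQ : q ^ 2 < 1 := pow_lt_one₀ hq0.le hq1 two_ne_zero
  have hsum : Summable (Function.uncurry fun k j : ℕ =>
      eulerTerm q y k * eulerTerm q (z * (q ^ 2) ^ k) j) := by
    refine .of_norm_bounded ((summable_eulerTerm hq0 hq1 y).norm.mul_of_nonneg
      (summable_eulerTerm hq0 hq1 z).norm (fun _ => norm_nonneg _) fun _ => norm_nonneg _) ?_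
    rintro ⟨k, j⟩
    simp only [Function.uncurry, eulerTerm_mul, norm_mul]
    refine mul_le_mul_of_nonneg_left (mul_le_of_le_one_left (norm_nonneg _) ?_) (norm_nonneg _)
    rw [Real.norm_of_nonneg (by positivity)]
    exact pow_le_one₀ (by positivity) (pow_le_one₀ (by positivity) hQ.le)
  simp only [← tsum_eulerTerm hq0 hq1, ← tsum_mul_left]
  rw [← hsum.tsum_comm]
  refine tsum_congr fun j => tsum_congr fun k => ?_
  simp only [eulerTerm_mul, ← pow_mul]
  ring

theorem Jz_eq_tsum_eulerTerm {q : ℝ} (hq0 : 0 < q) (n : ℤ) (x : ℝ) :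
    Jz q n x = x ^ n * (∑' k, eulerTerm q (q ^ 2 * x ^ 2) k *
      qpInf (q ^ 2) (q ^ (2 * n + 2) * (q ^ 2) ^ k)) / qpInf (q ^ 2) (q ^ 2) := by
  have h (k : ℕ) : q ^ (2 * n + 2 + 2 * (k : ℤ)) = q ^ (2 * n + 2) * (q ^ 2) ^ k := by
    rw [zpow_add₀ hq0.ne', zpow_mul q 2 (k : ℤ), zpow_natCast]
    norm_cast
  simp only [Jz, eulerTerm, h, div_mul_eq_mul_div]

/-- The symmetry `J_n(q^a;q²) = J_a(q^n;q²)`. -/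
theorem Jz_zpow_comm {q : ℝ} (hq0 : 0 < q) (hq1 : q < 1) (n a : ℤ) :
    Jz q n (q ^ a) = Jz q a (q ^ n) := by
  have h (b : ℤ) : q ^ 2 * (q ^ b) ^ 2 = q ^ (2 * b + 2) := by
    rw [zpow_add₀ hq0.ne', mul_comm 2 b, zpow_mul, mul_comm]
    norm_cast
  rw [Jz_eq_tsum_eulerTerm hq0, Jz_eq_tsum_eulerTerm hq0, h, h,
    tsum_eulerTerm_mul_qpInf_comm hq0 hq1, ← zpow_mul, ← zpow_mul, mul_comm n a]

theorem Jz_neg_natCast {q : ℝ} (hq0 : 0 < q) (hq1 : q < 1) (n : ℕ) {x : ℝ} (hx : x ≠ 0) :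
    Jz q (-n) x = (-q) ^ n * Jz q n (x * q ^ n) := by
  have hQ0 : 0 < q ^ 2 := pow_pos hq0 2
  have hQ : q ^ 2 < 1 := pow_lt_one₀ hq0.le hq1 two_ne_zero
  rw [Jz_eq_tsum_eulerTerm hq0, Jz_eq_tsum_eulerTerm hq0, ← mul_div_assoc,
    ← mul_assoc, ← tsum_mul_left, ← tsum_mul_left]
  congr 1
  have harg (k : ℕ) : q ^ (2 * (-n : ℤ) + 2) * (q ^ 2) ^ k * (q ^ 2) ^ n
      = q ^ 2 * (q ^ 2) ^ k := by
    rw [zpow_add₀ hq0.ne', zpow_mul, zpow_neg, zpow_natCast]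
    have := hq0.ne'
    norm_cast
    field_simp
  have hshift (m : ℕ) : q ^ (2 * (-n : ℤ) + 2) * (q ^ 2) ^ (m + n) = q ^ 2 * (q ^ 2) ^ m := by
    rw [pow_add, ← mul_assoc, harg]
  rw [← (add_left_injective n).tsum_eq]
  · refine tsum_congr fun m => ?_
    have hexp : (m + n) * (m + n - 1) + (m + n) = m * (m - 1) + m + n * n + 2 * m * n := by
      have (j : ℕ) : j * (j - 1) + j = j * j := by
        cases j with
        | zero => rfl
        | succ j => simp only [Nat.add_sub_cancel]; ring
      rw [this, this]
      ring
    have hpos : q ^ (2 * (n : ℤ) + 2) * (q ^ 2) ^ m = q ^ 2 * (q ^ 2) ^ m * (q ^ 2) ^ n := by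
      rw [zpow_add₀ hq0.ne', zpow_mul, zpow_natCast]
      norm_cast
      ring
    have hqp : qp (q ^ 2) (q ^ 2 * (q ^ 2) ^ m) n ≠ 0 := by
      have := (qp_self_pos hQ0 hQ (m + n)).ne'
      rw [qp_add] at this
      exact right_ne_zero_of_mul this
    have hqm := (qp_self_pos hQ0 hQ m).ne'
    have hpow : q ^ ((m + n) * (m + n - 1)) * q ^ (m + n)
        = q ^ (m * (m - 1)) * q ^ m * q ^ (n * n) * q ^ (2 * m * n) := by
      simp only [← pow_add, hexp]
    have hq := hq0.ne'
    simp only [hshift, hpos]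
    rw [qpInf_eq_qp_mul hQ0 hQ (q ^ 2 * (q ^ 2) ^ m) n]
    simp only [eulerTerm, qp_add, zpow_neg, zpow_natCast]
    field_simp
    rw [neg_pow q]
    generalize qpInf (q ^ 2) (q ^ 2 * (q ^ 2) ^ m * (q ^ 2) ^ n) = I
    linear_combination (-1) ^ (m + n) * q ^ (m + n) * (x ^ 2) ^ (m + n) * I * hpow
  · intro k hk
    by_contra hkn
    have hlt : k < n := by
      by_contra! h
      exact hkn ⟨k - n, Nat.sub_add_cancel h⟩
    refine hk ?_
    have hzero : q ^ (2 * (-n : ℤ) + 2) * (q ^ 2) ^ k * (q ^ 2) ^ (n - 1 - k) = 1 := by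
      have h := harg k
      have hn : n = n - 1 - k + (k + 1) := by omega
      rw [show (q ^ 2) ^ n = (q ^ 2) ^ (n - 1 - k) * (q ^ 2 * (q ^ 2) ^ k) by
        rw [← pow_succ', ← pow_add, ← hn], ← mul_assoc] at h
      exact mul_right_cancel₀ (by positivity) (h.trans (one_mul _).symm)
    simp only [qpInf_eq_zero hQ0 hQ _ hzero, mul_zero]

/-- The reflection `J_{-n}(x;q²) = (-q)^n J_n(x q^n;q²)`. -/
theorem Jz_neg {q : ℝ} (hq0 : 0 < q) (hq1 : q < 1) (n : ℤ) {x : ℝ} (hx : x ≠ 0) :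
    Jz q (-n) x = (-q) ^ n * Jz q n (x * q ^ n) := by
  have hq : -q ≠ 0 := neg_ne_zero.2 hq0.ne'
  obtain ⟨k, rfl | rfl⟩ := n.eq_nat_or_neg
  · simpa using Jz_neg_natCast hq0 hq1 k hx
  · rw [Jz_neg_natCast hq0 hq1 k (mul_ne_zero hx (zpow_ne_zero _ hq0.ne')), mul_assoc x,
      ← zpow_natCast q k, ← zpow_add₀ hq0.ne', ← zpow_natCast (-q) k, ← mul_assoc,
      ← zpow_add₀ hq]
    simp

/-- `(-q)^{-p} P⁰(p,v,w)` is symmetric in `p`, `v`, `w` (the two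
transpositions below generate all permutations), and `P⁰(p,v,w) = P⁰(p-1,v-1,w-1)`. -/
theorem Pzero_symmetric_and_shift (q : ℝ) (hq0 : 0 < q) (hq1 : q < 1) (p v w : ℤ) :
    ((-q) ^ (-p) * Pzero q p v w = (-q) ^ (-v) * Pzero q v p w ∧
      (-q) ^ (-p) * Pzero q p v w = (-q) ^ (-p) * Pzero q p w v) ∧
    Pzero q p v w = Pzero q (p - 1) (v - 1) (w - 1) := by
  have hq : -q ≠ 0 := neg_ne_zero.2 hq0.ne'
  have key (a b c : ℤ) :
      (-q) ^ (-a) * Pzero q a b c = (-q) ^ (-c) * Jz q (b - c) (q ^ (a - c)) := by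
    rw [Pzero, ← mul_assoc, ← zpow_add₀ hq]
    congr 2
    ring
  refine ⟨⟨?_, ?_⟩, ?_⟩
  · rw [key, key, Jz_zpow_comm hq0 hq1]
  · rw [key, key, ← neg_sub v w, Jz_neg hq0 hq1 _ (zpow_ne_zero _ hq0.ne'), ← mul_assoc,
      ← zpow_add₀ hq, ← zpow_add₀ hq0.ne']
    congr 2 <;> ring_nf
  · simp [Pzero]
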